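/- Let M ≥ 1 and 0 ≤ F ≤ M−1. The number of ranking-compatible functions f : {1,…,M} → {1,…,M} having exactly F followers equals the Eulerian number ⟨M F⟩, i.e., the number of permutations σ of {1,…,M} with exactly F descents. Hence the probability distribution of the number of followers of a uniformly random ranking-compatible map is Π(F,M) = ⟨M F⟩/M!. -/

import Mathlib

/-- number of followers -/
def foll {n : ℕ} (f : Fin n → Fin n) : ℕ :=
  (Finset.univ.filter (fun i : Fin n => ∀ x : Fin n, f x ≠ i)).card

/-- ranking-compatible maps -/
def rcm (n : ℕ) : Finset (Fin n → Fin n) := Finset.univ.filter (fun f => ∀ i, i ≤ f i)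

/-- descent set -/
def desS {n : ℕ} (σ : Equiv.Perm (Fin n)) : Finset ℕ :=
  (Finset.range n).filter (fun i => ∃ h : i + 1 < n, σ ⟨i + 1, h⟩ < σ ⟨i, Nat.lt_of_succ_lt h⟩)

theorem mem_desS {n : ℕ} (σ : Equiv.Perm (Fin n)) (i : ℕ) :
    i ∈ desS σ ↔ ∃ h : i + 1 < n, σ ⟨i + 1, h⟩ < σ ⟨i, Nat.lt_of_succ_lt h⟩ := by
  unfold desS
  rw [Finset.mem_filter, Finset.mem_range]
  constructor
  · exact fun h => h.2
  · exact fun h => ⟨by obtain ⟨h, _⟩ := h; omega, h⟩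

theorem sum_ite_mem_count {α : Type*} [Fintype α] [DecidableEq α] (S : Finset α) (x y : ℕ) :
    (∑ a : α, if a ∈ S then x else y) = S.card * x + (Fintype.card α - S.card) * y := by
  rw [Finset.sum_ite]
  simp only [Finset.sum_const, smul_eq_mul]
  congr 2
  · congr 1; ext; simp
  · rw [← Finset.card_compl]; congr 1; ext; simp

theorem foll_cons {n : ℕ} (g : Fin n → Fin n) (h : ℕ → ℕ) :
    (∑ a : Fin (n + 1), h (foll (Fin.cons a (fun i => (g i).succ) : Fin (n + 1) → Fin (n + 1))))
      = (foll g + 1) * h (foll g) + (n - foll g) * h (foll g + 1) := by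
  set S : Finset (Fin (n + 1)) := Finset.univ.filter (fun i => ∀ x, (g x).succ ≠ i) with hS
  have hc : S.card = foll g + 1 := by
    have : S = insert 0 ((Finset.univ.filter (fun i : Fin n => ∀ x : Fin n, g x ≠ i)).map
        (Fin.succEmb n)) := by
      ext i
      refine Fin.cases ?_ (fun i => ?_) i
      · simp [hS]
      · simp [hS, Fin.succ_ne_zero]
    rw [this, Finset.card_insert_of_notMem, Finset.card_map, foll]
    simp [Fin.succ_ne_zero]
  have hf : ∀ a, foll (Fin.cons a (fun i => (g i).succ) : Fin (n + 1) → Fin (n + 1))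
      = (S.erase a).card := by
    intro a
    unfold foll
    congr 1
    ext i
    simp [hS, Fin.forall_fin_succ, ne_comm]
  have : ∀ a, h (foll (Fin.cons a (fun i => (g i).succ) : Fin (n + 1) → Fin (n + 1)))
      = if a ∈ S then h (foll g) else h (foll g + 1) := by
    intro a
    rw [hf]
    split_ifs with ha
    · rw [Finset.card_erase_of_mem ha, hc]; rfl
    · rw [Finset.erase_eq_of_notMem ha, hc]
  simp only [this]
  rw [sum_ite_mem_count, hc]
  simp

theorem sum_rcm_succ (n : ℕ) (h : ℕ → ℕ) :
    ∑ f ∈ rcm (n + 1), h (foll f)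
      = ∑ g ∈ rcm n, ((foll g + 1) * h (foll g) + (n - foll g) * h (foll g + 1)) := by
  simp only [← foll_cons]
  rw [← Finset.sum_product']
  symm
  refine Finset.sum_bij (fun p _ => Fin.cons p.2 (fun i => (p.1 i).succ)) ?_ ?_ ?_ ?_
  · rintro ⟨g, a⟩ hp
    simp only [rcm, Finset.mem_product, Finset.mem_filter, Finset.mem_univ, true_and,
      and_true] at hp ⊢
    intro i
    refine Fin.cases ?_ (fun i => ?_) i
    · simp
    · simpa using hp i
  · rintro ⟨g, a⟩ _ ⟨g', a'⟩ _ he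
    simp only [Fin.cons_inj] at he
    obtain ⟨rfl, he⟩ := he
    congr 1
    funext i
    exact Fin.succ_injective _ (congrFun he i)
  · intro f hf
    simp only [rcm, Finset.mem_filter, Finset.mem_univ, true_and] at hf
    have h0 : ∀ i : Fin n, f i.succ ≠ 0 := by
      intro i h0
      have := hf i.succ
      rw [h0] at this
      exact absurd this (by simp)
    refine ⟨(fun i => (f i.succ).pred (h0 i), f 0), ?_, ?_⟩
    · simp only [rcm, Finset.mem_product, Finset.mem_filter, Finset.mem_univ, true_and, and_true]
      intro i
      rw [Fin.le_pred_iff]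
      exact hf _
    · funext i
      refine Fin.cases ?_ (fun i => ?_) i <;> simp
  · intros; rfl

/-- insert the maximum at position p -/
def insMax {n : ℕ} (p : Fin (n + 1)) (σ : Equiv.Perm (Fin n)) : Equiv.Perm (Fin (n + 1)) :=
  ((finSuccEquiv' p).trans (Equiv.optionCongr σ)).trans (finSuccEquiv' (Fin.last n)).symm

theorem insMax_self {n : ℕ} (p : Fin (n + 1)) (σ : Equiv.Perm (Fin n)) :
    insMax p σ p = Fin.last n := by
  simp [insMax]

theorem insMax_succAbove {n : ℕ} (p : Fin (n + 1)) (σ : Equiv.Perm (Fin n)) (j : Fin n) :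
    insMax p σ (p.succAbove j) = (σ j).castSucc := by
  simp [insMax]

theorem insMax_lt {n : ℕ} (p : Fin (n + 1)) (σ : Equiv.Perm (Fin n)) (j : ℕ) (hj : j < p.val)
    (h : j < n + 1) (h' : j < n) : insMax p σ ⟨j, h⟩ = (σ ⟨j, h'⟩).castSucc := by
  rw [← insMax_succAbove p, Fin.succAbove_of_castSucc_lt]
  · rfl
  · exact hj

theorem insMax_gt {n : ℕ} (p : Fin (n + 1)) (σ : Equiv.Perm (Fin n)) (j : ℕ) (hj : p.val ≤ j)
    (h : j + 1 < n + 1) (h' : j < n) : insMax p σ ⟨j + 1, h⟩ = (σ ⟨j, h'⟩).castSucc := by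
  rw [← insMax_succAbove p, Fin.succAbove_of_le_castSucc]
  · rfl
  · exact hj

theorem insMax_eq {n : ℕ} (p : Fin (n + 1)) (σ : Equiv.Perm (Fin n)) (j : ℕ) (hj : j = p.val)
    (h : j < n + 1) : insMax p σ ⟨j, h⟩ = Fin.last n := by
  subst hj; exact insMax_self p σ

theorem insMax_bij (n : ℕ) :
    Function.Bijective (fun q : Equiv.Perm (Fin n) × Fin (n + 1) => insMax q.2 q.1) := by
  rw [Fintype.bijective_iff_injective_and_card]
  constructor
  · rintro ⟨σ, p⟩ ⟨τ, q⟩ he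
    simp only at he
    have hp : p = q := by
      apply (insMax p σ).injective
      rw [insMax_self, he, insMax_self]
    subst hp
    congr 1
    ext j : 1
    apply Fin.castSucc_injective
    rw [← insMax_succAbove p, ← insMax_succAbove p, he]
  · simp [Fintype.card_perm, Nat.factorial_succ, mul_comm]

theorem desS_insMax {n : ℕ} (p : Fin (n + 1)) (σ : Equiv.Perm (Fin n)) :
    desS (insMax p σ) = ((desS σ).filter (fun i => i + 1 < p.val)
      ∪ ((desS σ).filter (fun i => p.val ≤ i)).image Nat.succ)
      ∪ (if p.val < n then {p.val} else ∅) := by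
  ext i
  have hp := p.isLt
  simp only [Finset.mem_union, Finset.mem_filter, Finset.mem_image]
  rw [mem_desS]
  have hmem : i ∈ (if p.val < n then ({p.val} : Finset ℕ) else ∅) ↔ i = p.val ∧ p.val < n := by
    split_ifs with h <;> simp [h]
  rw [hmem]
  rcases lt_trichotomy i p.val with hi | hi | hi
  · rcases Nat.lt_or_ge (i + 1) p.val with h1 | h1
    · have e1 := insMax_lt p σ i hi (by omega) (by omega)
      have e2 := insMax_lt p σ (i + 1) h1 (by omega) (by omega)
      constructor
      · rintro ⟨h, hd⟩
        rw [e1, e2] at hd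
        exact Or.inl (Or.inl ⟨(mem_desS _ _).2 ⟨by omega, by simpa using hd⟩, h1⟩)
      · rintro ((⟨hd, _⟩ | ⟨a, ⟨_, ha⟩, rfl⟩) | h)
        · obtain ⟨h, hd⟩ := (mem_desS _ _).1 hd
          refine ⟨by omega, ?_⟩
          rw [e1, e2]
          simpa using hd
        · omega
        · omega
    · have e2 : i + 1 = p.val := by omega
      constructor
      · rintro ⟨h, hd⟩
        rw [insMax_eq p σ (i + 1) e2] at hd
        exact absurd hd (not_lt.2 (Fin.le_last _))
      · rintro ((⟨_, _⟩ | ⟨a, ⟨_, ha⟩, rfl⟩) | h) <;> omega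
  · constructor
    · rintro ⟨h, _⟩
      exact Or.inr ⟨hi, by omega⟩
    · rintro ((⟨_, _⟩ | ⟨a, ⟨_, ha⟩, rfl⟩) | h)
      · omega
      · omega
      · refine ⟨by omega, ?_⟩
        rw [insMax_eq p σ i hi, insMax_gt p σ i (by omega) (by omega) (by omega)]
        exact Fin.castSucc_lt_last _
  · obtain ⟨k, rfl⟩ : ∃ k, i = k + 1 := ⟨i - 1, by omega⟩
    constructor
    · rintro ⟨h, hd⟩
      rw [insMax_gt p σ k (by omega) (by omega) (by omega),
        insMax_gt p σ (k + 1) (by omega) (by omega) (by omega)] at hd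
      exact Or.inl (Or.inr ⟨k, ⟨(mem_desS _ _).2 ⟨by omega, by simpa using hd⟩, by omega⟩, rfl⟩)
    · rintro ((⟨_, _⟩ | ⟨a, ⟨hd, ha⟩, he⟩) | h)
      · omega
      · obtain rfl : a = k := by omega
        obtain ⟨h, hd⟩ := (mem_desS _ _).1 hd
        refine ⟨by omega, ?_⟩
        rw [insMax_gt p σ a (by omega) (by omega) (by omega),
          insMax_gt p σ (a + 1) (by omega) (by omega) (by omega)]
        simpa using hd
      · omega

/-- positions at which inserting the maximum keeps the descent number -/
def keepS {n : ℕ} (σ : Equiv.Perm (Fin n)) : Finset ℕ := insert n ((desS σ).image Nat.succ)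

theorem card_desS_insMax {n : ℕ} (p : Fin (n + 1)) (σ : Equiv.Perm (Fin n)) :
    (desS (insMax p σ)).card = if p.val ∈ keepS σ then (desS σ).card else (desS σ).card + 1 := by
  have hp := p.isLt
  have hD : ∀ i ∈ desS σ, i + 1 < n := fun i hi => by
    obtain ⟨h, _⟩ := (mem_desS _ _).1 hi; exact h
  have h3 : (if p.val < n then ({p.val} : Finset ℕ) else ∅).card = if p.val < n then 1 else 0 := by
    split_ifs <;> simp
  have hm : (desS σ).card = ((desS σ).filter (fun i => i + 1 < p.val)).card
      + ((desS σ).filter (fun i => p.val ≤ i)).card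
      + ((desS σ).filter (fun i => i + 1 = p.val)).card := by
    rw [← Finset.card_union_of_disjoint, ← Finset.card_union_of_disjoint]
    · congr 1
      ext i
      simp only [Finset.mem_union, Finset.mem_filter]
      have : i + 1 < p.val ∨ p.val ≤ i ∨ i + 1 = p.val := by omega
      tauto
    · rw [Finset.disjoint_left]
      intro i
      simp only [Finset.mem_union, Finset.mem_filter]
      omega
    · rw [Finset.disjoint_left]
      intro i
      simp only [Finset.mem_filter]
      omega
  have h4 : ((desS σ).filter (fun i => i + 1 = p.val)).card
      = if p.val ∈ (desS σ).image Nat.succ then 1 else 0 := by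
    split_ifs with h
    · obtain ⟨a, ha, he⟩ := Finset.mem_image.1 h
      rw [Finset.card_eq_one]
      refine ⟨a, ?_⟩
      ext i
      simp only [Finset.mem_filter, Finset.mem_singleton]
      constructor
      · rintro ⟨_, h⟩; omega
      · rintro rfl; exact ⟨ha, he⟩
    · rw [Finset.card_eq_zero, Finset.filter_eq_empty_iff]
      intro i hi he
      exact h (Finset.mem_image.2 ⟨i, hi, he⟩)
  rw [desS_insMax, Finset.card_union_of_disjoint, Finset.card_union_of_disjoint,
    Finset.card_image_of_injective _ Nat.succ_injective, h3]
  · rw [hm, h4, keepS]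
    simp only [Finset.mem_insert]
    by_cases hpn : p.val = n
    · have : p.val ∉ (desS σ).image Nat.succ := by
        intro h
        obtain ⟨a, ha, he⟩ := Finset.mem_image.1 h
        have := hD a ha
        omega
      rw [if_neg this, if_neg (by omega), if_pos (Or.inl hpn)]
    · have : p.val < n := by omega
      by_cases hh : p.val ∈ (desS σ).image Nat.succ
      · simp only [hh, this]; simp
      · simp only [hh, this, hpn]; simp
  · rw [Finset.disjoint_left]
    intro i
    simp only [Finset.mem_filter, Finset.mem_image]
    rintro ⟨_, h⟩ ⟨a, ⟨_, h'⟩, h''⟩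
    omega
  · rw [Finset.disjoint_left]
    intro i
    simp only [Finset.mem_union, Finset.mem_filter, Finset.mem_image]
    intro h hi
    have : i = p.val := by
      split_ifs at hi <;> simp_all
    rcases h with ⟨_, h⟩ | ⟨a, ⟨_, h'⟩, h''⟩ <;> omega

theorem sum_perm_succ (n : ℕ) (h : ℕ → ℕ) :
    ∑ σ : Equiv.Perm (Fin (n + 1)), h (desS σ).card
      = ∑ σ : Equiv.Perm (Fin n), (((desS σ).card + 1) * h (desS σ).card
          + (n - (desS σ).card) * h ((desS σ).card + 1)) := by
  rw [← (insMax_bij n).sum_comp (fun σ => h (desS σ).card), Fintype.sum_prod_type]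
  refine Finset.sum_congr rfl fun σ _ => ?_
  have hD : ∀ i ∈ desS σ, i + 1 < n := fun i hi => by
    obtain ⟨h, _⟩ := (mem_desS _ _).1 hi; exact h
  have hK : (keepS σ).card = (desS σ).card + 1 := by
    rw [keepS, Finset.card_insert_of_notMem, Finset.card_image_of_injective _ Nat.succ_injective]
    intro h
    obtain ⟨a, ha, he⟩ := Finset.mem_image.1 h
    have := hD a ha
    omega
  set S : Finset (Fin (n + 1)) := Finset.univ.filter (fun p => p.val ∈ keepS σ) with hS
  have hSc : S.card = (desS σ).card + 1 := by
    rw [← hK, ← Finset.card_map Fin.valEmbedding]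
    congr 1
    ext i
    simp only [hS, Finset.mem_map, Finset.mem_filter, Finset.mem_univ, true_and,
      Fin.valEmbedding_apply]
    constructor
    · rintro ⟨a, ha, rfl⟩; exact ha
    · intro hi
      have : i < n + 1 := by
        rcases Finset.mem_insert.1 hi with rfl | h
        · omega
        · obtain ⟨a, ha, he⟩ := Finset.mem_image.1 h
          have := hD a ha
          omega
      exact ⟨⟨i, this⟩, hi, rfl⟩
  have : ∀ p : Fin (n + 1), h (desS (insMax p σ)).card
      = if p ∈ S then h (desS σ).card else h ((desS σ).card + 1) := by
    intro p
    rw [card_desS_insMax]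
    simp only [hS, Finset.mem_filter, Finset.mem_univ, true_and]
    split_ifs <;> rfl
  simp only [this]
  rw [sum_ite_mem_count, hSc]
  simp

theorem sum_eq (n : ℕ) : ∀ h : ℕ → ℕ,
    ∑ f ∈ rcm n, h (foll f) = ∑ σ : Equiv.Perm (Fin n), h (desS σ).card := by
  induction n with
  | zero => intro h; simp [rcm, foll, desS]
  | succ n ih =>
    intro h
    rw [sum_rcm_succ, sum_perm_succ]
    exact ih (fun k => (k + 1) * h k + (n - k) * h (k + 1))

/-- The number of ranking-compatible maps `f : Fin M → Fin M` with exactly `F`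
followers (elements outside the image of `f`) equals the Eulerian number: the
number of permutations of `Fin M` with exactly `F` descents. -/
theorem stmt15 (M F : ℕ) (hM : 1 ≤ M) (hF : F ≤ M - 1) :
    Set.ncard {f : Fin M → Fin M |
        (∀ i : Fin M, i ≤ f i) ∧
        (Finset.univ.filter (fun i : Fin M => ∀ x : Fin M, f x ≠ i)).card = F}
      = Set.ncard {σ : Equiv.Perm (Fin M) |
          Set.ncard {i : ℕ | ∃ h : i + 1 < M,
            σ ⟨i + 1, h⟩ < σ ⟨i, Nat.lt_of_succ_lt h⟩} = F} := by
  have key := sum_eq M (fun k => if k = F then 1 else 0)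
  rw [← Finset.card_filter, ← Finset.card_filter] at key
  rw [← Set.ncard_coe_finset, ← Set.ncard_coe_finset] at key
  convert key using 2
  · ext f
    simp [rcm, foll]
  · ext σ
    have : {i : ℕ | ∃ h : i + 1 < M, σ ⟨i + 1, h⟩ < σ ⟨i, Nat.lt_of_succ_lt h⟩}
        = (desS σ : Set ℕ) := by
      ext i
      simp only [Set.mem_ofPred_eq, Finset.mem_coe, mem_desS]
    simp only [Set.mem_ofPred_eq, this, Set.ncard_coe_finset]
    simp
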